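/- arXiv:1510.07190 — 2 statements merged into one kernel-verified Lean document; each statement's English description precedes it below -/
import Mathlib

section
/- Let j ≥ 3 and let τ = τ_1⋯τ_j ∈ S_j be minimal overlapping with τ_1 = 1 and τ_j = s where 2 ≤ s < j. Then for all n ≥ 0, mp_{τ,(n+1)(j−1)+1}(p,q) = (p^{coinv(τ)} q^{inv(τ)})^{n+1} · p^{(s−1)(j−1)·binom(n+1,2)} · Π_{i=1}^{n+1} [i(j−1)+1−s choose j−s]_{p,q}, as polynomials in p and q. -/
open scoped Classical

noncomputable section

namespace CWilf

/-- The number of descents of a permutation of `{0, …, n-1}` (0-based). -/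
def des {n : ℕ} (σ : Equiv.Perm (Fin n)) : ℕ :=
  (Finset.univ.filter fun i : Fin n =>
    ∃ h : (i : ℕ) + 1 < n, σ ⟨(i : ℕ) + 1, h⟩ < σ i).card

/-- The number of inversions of `σ`. -/
def inv {n : ℕ} (σ : Equiv.Perm (Fin n)) : ℕ :=
  (Finset.univ.filter fun q : Fin n × Fin n => q.1 < q.2 ∧ σ q.2 < σ q.1).card

/-- The number of coinversions of `σ`. -/
def coinv {n : ℕ} (σ : Equiv.Perm (Fin n)) : ℕ :=
  (Finset.univ.filter fun q : Fin n × Fin n => q.1 < q.2 ∧ σ q.1 < σ q.2).card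

/-- The number of left-to-right minima of `σ`. -/
def LRmin {n : ℕ} (σ : Equiv.Perm (Fin n)) : ℕ :=
  (Finset.univ.filter fun j : Fin n => ∀ i : Fin n, i < j → σ j < σ i).card

/-- There is a `τ`-match of `σ` starting at (0-based) position `i`, i.e.
`red(σ_i σ_{i+1} ⋯ σ_{i+j-1}) = τ`. -/
def MatchAt {j n : ℕ} (τ : Equiv.Perm (Fin j)) (σ : Equiv.Perm (Fin n)) (i : ℕ) : Prop :=
  ∃ h : i + j ≤ n, ∀ a b : Fin j,
    τ a < τ b ↔
      σ ⟨i + (a : ℕ), by have := a.isLt; omega⟩ < σ ⟨i + (b : ℕ), by have := b.isLt; omega⟩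

/-- The number of `τ`-matches of `σ`. -/
def mch {j n : ℕ} (τ : Equiv.Perm (Fin j)) (σ : Equiv.Perm (Fin n)) : ℕ :=
  ((Finset.range n).filter fun i => MatchAt τ σ i).card

/-- `τ` is minimal overlapping: the smallest `n` such that some `σ ∈ S_n` has
exactly two `τ`-matches is `2j - 1`. -/
def MinOverlapping {j : ℕ} (τ : Equiv.Perm (Fin j)) : Prop :=
  IsLeast {n : ℕ | ∃ σ : Equiv.Perm (Fin n), mch τ σ = 2} (2 * j - 1)

/-- `α` and `β` are mutually minimal overlapping. -/
def MutuallyMinOverlapping {j : ℕ} (α β : Equiv.Perm (Fin j)) : Prop :=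
  MinOverlapping α ∧ MinOverlapping β ∧
    IsLeast {n : ℕ | ∃ σ : Equiv.Perm (Fin n), 1 ≤ mch α σ ∧ 1 ≤ mch β σ} (2 * j - 1)

/-- The set of permutations of `S_n` with no `τ`-match. -/
def NM (n : ℕ) {j : ℕ} (τ : Equiv.Perm (Fin j)) : Finset (Equiv.Perm (Fin n)) :=
  Finset.univ.filter fun σ => mch τ σ = 0

/-- The `p,q`-analogue `[n]_{p,q} = p^{n-1} + p^{n-2}q + ⋯ + q^{n-1}`. -/
def pqInt {K : Type} [CommSemiring K] (p q : K) (n : ℕ) : K :=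
  ∑ i ∈ Finset.range n, p ^ (n - 1 - i) * q ^ i

/-- The `p,q`-factorial `[n]_{p,q}!`. -/
def pqFact {K : Type} [CommSemiring K] (p q : K) : ℕ → K
  | 0 => 1
  | n + 1 => pqFact p q n * pqInt p q (n + 1)

/-- The `p,q`-binomial coefficient, taken to be `0` when `k > n`. -/
def pqBinom {K : Type} [Field K] (p q : K) (n k : ℕ) : K :=
  if k ≤ n then pqFact p q n / (pqFact p q k * pqFact p q (n - k)) else 0

/-- The `q`-analogue `[n]_q = 1 + q + ⋯ + q^{n-1}`. -/
def qInt {K : Type} [CommSemiring K] (q : K) (n : ℕ) : K :=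
  ∑ i ∈ Finset.range n, q ^ i

/-- The `q`-factorial `[n]_q!`. -/
def qFact {K : Type} [CommSemiring K] (q : K) : ℕ → K
  | 0 => 1
  | n + 1 => qFact q n * qInt q (n + 1)

/-- The `q`-binomial coefficient, taken to be `0` when `k > n`. -/
def qBinom {K : Type} [Field K] (q : K) (n k : ℕ) : K :=
  if k ≤ n then qFact q n / (qFact q k * qFact q (n - k)) else 0

/-- `mp_{τ, n(j-1)+1}(p,q)`, the generating polynomial
`Σ_{σ ∈ MP_{τ,n(j-1)+1}} q^{inv σ} p^{coinv σ}` over maximum packings for `τ`. -/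
def mpSum {j : ℕ} (τ : Equiv.Perm (Fin j)) (n : ℕ) {K : Type} [CommSemiring K] (p q : K) : K :=
  ∑ σ ∈ Finset.univ.filter (fun σ : Equiv.Perm (Fin (n * (j - 1) + 1)) => mch τ σ = n),
    q ^ inv σ * p ^ coinv σ

/-- The field `ℚ(p,q)` of rational functions in two variables. -/
abbrev K2 : Type := FractionRing (MvPolynomial (Fin 2) ℚ)

/-- The variable `p` in `ℚ(p,q)`. -/
def pW : K2 := algebraMap (MvPolynomial (Fin 2) ℚ) K2 (MvPolynomial.X 0)
/-- The variable `q` in `ℚ(p,q)`. -/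
def qW : K2 := algebraMap (MvPolynomial (Fin 2) ℚ) K2 (MvPolynomial.X 1)

/-- The one-line notation of `σ` as a function on `ℕ`, with value `0` beyond the last position. -/
def word {n : ℕ} (σ : Equiv.Perm (Fin n)) (i : ℕ) : ℕ :=
  if h : i < n then (σ ⟨i, h⟩ : ℕ) else 0

lemma word_of_lt {n : ℕ} (σ : Equiv.Perm (Fin n)) {i : ℕ} (h : i < n) :
    word σ i = (σ ⟨i, h⟩ : ℕ) := dif_pos h

lemma word_val {n : ℕ} (σ : Equiv.Perm (Fin n)) (i : Fin n) : word σ i = (σ i : ℕ) :=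
  word_of_lt σ i.isLt

lemma word_lt {n : ℕ} (σ : Equiv.Perm (Fin n)) {i : ℕ} (h : i < n) : word σ i < n := by
  rw [word_of_lt σ h]
  exact Fin.isLt _

lemma word_inj {n : ℕ} (σ : Equiv.Perm (Fin n)) {i k : ℕ} (hi : i < n) (hk : k < n)
    (h : word σ i = word σ k) : i = k := by
  rw [word_of_lt σ hi, word_of_lt σ hk] at h
  exact congrArg Fin.val (σ.injective (Fin.ext h))

lemma word_surj {n : ℕ} (σ : Equiv.Perm (Fin n)) {v : ℕ} (hv : v < n) :
    ∃ i < n, word σ i = v := by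
  refine ⟨σ.symm ⟨v, hv⟩, Fin.isLt _, ?_⟩
  rw [word_val]
  simp

lemma word_ext {n : ℕ} {σ σ' : Equiv.Perm (Fin n)} (h : ∀ i < n, word σ i = word σ' i) :
    σ = σ' := by
  ext i
  rw [← word_val, ← word_val]
  exact h i i.isLt

lemma exists_perm_word_eq {n : ℕ} (f : ℕ → ℕ) (hf : ∀ i < n, f i < n)
    (hinj : ∀ i < n, ∀ k < n, f i = f k → i = k) :
    ∃ σ : Equiv.Perm (Fin n), ∀ i < n, word σ i = f i := by
  let g : Fin n → Fin n := fun i => ⟨f i, hf i i.isLt⟩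
  have hg : Function.Injective g := fun a b hab =>
    Fin.ext (hinj a a.isLt b b.isLt (congrArg Fin.val hab))
  refine ⟨Equiv.ofBijective g (Finite.injective_iff_bijective.mp hg), fun i hi => ?_⟩
  rw [word_of_lt _ hi]
  rfl

lemma matchAt_iff {j n : ℕ} (τ : Equiv.Perm (Fin j)) (σ : Equiv.Perm (Fin n)) (i : ℕ) :
    MatchAt τ σ i ↔ i + j ≤ n ∧ ∀ a < j, ∀ b < j,
      (word τ a < word τ b ↔ word σ (i + a) < word σ (i + b)) := by
  constructor
  · rintro ⟨h, H⟩
    refine ⟨h, fun a ha b hb => ?_⟩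
    rw [word_of_lt τ ha, word_of_lt τ hb, word_of_lt σ (by omega : i + a < n),
      word_of_lt σ (by omega : i + b < n)]
    exact H ⟨a, ha⟩ ⟨b, hb⟩
  · rintro ⟨h, H⟩
    refine ⟨h, fun a b => ?_⟩
    have := H a a.isLt b b.isLt
    rwa [word_val, word_val, word_of_lt σ (by omega : i + (a : ℕ) < n),
      word_of_lt σ (by omega : i + (b : ℕ) < n)] at this

/-- A function on `{0, …, m-1}` is determined by its set of values and their relative order. -/
lemma eq_of_same_order {m : ℕ} {f g : ℕ → ℕ}
    (h : ∀ a < m, ∀ b < m, (f a < f b ↔ g a < g b))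
    (himg : (Finset.range m).image f = (Finset.range m).image g) :
    ∀ a < m, f a = g a := by
  suffices H : ∀ v, ∀ a < m, f a = v → f a = g a from fun a ha => H _ a ha rfl
  intro v
  induction v using Nat.strong_induction_on with
  | _ v ih =>
    intro a ha hv
    rcases lt_trichotomy (f a) (g a) with hlt | heq | hgt
    · have hmem : f a ∈ (Finset.range m).image g := by
        rw [← himg]
        exact Finset.mem_image_of_mem f (Finset.mem_range.mpr ha)
      obtain ⟨b, hb, hba⟩ := Finset.mem_image.mp hmem
      have hb := Finset.mem_range.mp hb
      have hfb : f b < f a := (h b hb a ha).mpr (by omega)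
      have := ih (f b) (by omega) b hb rfl
      omega
    · exact heq
    · have hmem : g a ∈ (Finset.range m).image f := by
        rw [himg]
        exact Finset.mem_image_of_mem g (Finset.mem_range.mpr ha)
      obtain ⟨b, hb, hba⟩ := Finset.mem_image.mp hmem
      have hb := Finset.mem_range.mp hb
      have hgb : g b < g a := (h b hb a ha).mp (by omega)
      have := ih (f b) (by omega) b hb rfl
      omega

lemma image_word_range {n : ℕ} (σ : Equiv.Perm (Fin n)) :
    (Finset.range n).image (word σ) = Finset.range n := by
  ext v
  simp only [Finset.mem_image, Finset.mem_range]
  constructor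
  · rintro ⟨i, hi, rfl⟩
    exact word_lt σ hi
  · exact fun hv => word_surj σ hv

lemma matchAt_unique {m n c : ℕ} {ρ ρ' : Equiv.Perm (Fin m)} {σ : Equiv.Perm (Fin n)}
    (h : MatchAt ρ σ c) (h' : MatchAt ρ' σ c) : ρ = ρ' := by
  rw [matchAt_iff] at h h'
  refine word_ext (eq_of_same_order (fun a ha b hb => ?_) ?_)
  · rw [h.2 a ha b hb, h'.2 a ha b hb]
  · rw [image_word_range, image_word_range]

lemma exists_matchAt {m n c : ℕ} (σ : Equiv.Perm (Fin n)) (h : c + m ≤ n) :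
    ∃ ρ : Equiv.Perm (Fin m), MatchAt ρ σ c := by
  let f : Fin m → Fin n := fun a => σ ⟨c + a, by have := a.isLt; omega⟩
  have hf : Function.Injective f := fun a b hab => by
    have := congrArg Fin.val (σ.injective hab)
    simp only at this
    exact Fin.ext (by omega)
  have hmono : StrictMono (f ∘ Tuple.sort f) :=
    (Tuple.monotone_sort f).strictMono_of_injective (hf.comp (Tuple.sort f).injective)
  refine ⟨(Tuple.sort f).symm, h, fun a b => ?_⟩
  rw [← hmono.lt_iff_lt]
  simp [f]

/-- Matches inside a window of `σ` are the matches of the pattern of that window. -/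
lemma matchAt_window {j m n c k : ℕ} (τ : Equiv.Perm (Fin j)) {ρ : Equiv.Perm (Fin m)}
    {σ : Equiv.Perm (Fin n)} (h : MatchAt ρ σ c) (hk : k + j ≤ m) :
    MatchAt τ ρ k ↔ MatchAt τ σ (c + k) := by
  rw [matchAt_iff] at h
  rw [matchAt_iff, matchAt_iff]
  refine and_congr ⟨fun _ => by omega, fun _ => hk⟩ ?_
  refine forall₂_congr fun a ha => forall₂_congr fun b hb => ?_
  rw [h.2 (k + a) (by omega) (k + b) (by omega), add_assoc, add_assoc]

lemma MinOverlapping.add_le {d n : ℕ} {τ : Equiv.Perm (Fin (d + 1))} (hτ : MinOverlapping τ)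
    {σ : Equiv.Perm (Fin n)} {i i' : ℕ} (hi : MatchAt τ σ i) (hi' : MatchAt τ σ i')
    (hlt : i < i') : i + d ≤ i' := by
  have hex : ∃ k, i < k ∧ MatchAt τ σ k := ⟨i', hlt, hi'⟩
  obtain ⟨hk, hkm⟩ := Nat.find_spec hex
  have hmin : ∀ l, i < l → l < Nat.find hex → ¬ MatchAt τ σ l := fun l h1 h2 h3 =>
    Nat.find_min hex h2 ⟨h1, h3⟩
  have hle : Nat.find hex ≤ i' := Nat.find_min' hex ⟨hlt, hi'⟩
  generalize Nat.find hex = k at *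
  have hkn := ((matchAt_iff _ _ _).mp hkm).1
  obtain ⟨ρ, hρ⟩ := exists_matchAt (m := (k - i) + (d + 1)) (c := i) σ (by omega)
  have hset : (Finset.range ((k - i) + (d + 1))).filter (fun l => MatchAt τ ρ l) = {0, k - i} := by
    ext l
    simp only [Finset.mem_filter, Finset.mem_range, Finset.mem_insert, Finset.mem_singleton]
    constructor
    · rintro ⟨-, hl⟩
      have hl' := ((matchAt_iff _ _ _).mp hl).1
      rw [matchAt_window τ hρ hl'] at hl
      by_contra hne
      exact hmin (i + l) (by omega) (by omega) hl
    · rintro (rfl | rfl)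
      · exact ⟨by omega, (matchAt_window τ hρ (by omega)).mpr hi⟩
      · refine ⟨by omega, (matchAt_window τ hρ (by omega)).mpr ?_⟩
        rwa [show i + (k - i) = k by omega]
  have h2 : mch τ ρ = 2 := by
    rw [mch, hset, Finset.card_pair (by omega)]
  have := hτ.2 ⟨ρ, h2⟩
  omega

lemma card_le_of_separated {d c K : ℕ} {S : Finset ℕ}
    (hsep : ∀ x ∈ S, ∀ y ∈ S, x < y → x + d ≤ y)
    (hS : ∀ x ∈ S, c ≤ x ∧ x < c + K * d) : S.card ≤ K := by
  rw [← Finset.card_range K]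
  refine Finset.card_le_card_of_injOn (fun x => (x - c) / d) (fun x hx => ?_)
    (fun x hx y hy hxy => ?_)
  · have := hS x hx
    exact Finset.mem_coe.mpr (Finset.mem_range.mpr (Nat.div_lt_of_lt_mul (by
      rw [mul_comm]; omega)))
  · have hx' := hS x hx
    have hy' := hS y hy
    simp only at hxy
    have hd : 0 < d := Nat.pos_of_ne_zero (by rintro rfl; omega)
    have h1 := Nat.div_add_mod (x - c) d
    have h2 := Nat.div_add_mod (y - c) d
    have h3 := Nat.mod_lt (x - c) hd
    have h4 := Nat.mod_lt (y - c) hd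
    rw [hxy] at h1
    rcases lt_trichotomy x y with h | h | h
    · have := hsep x hx y hy h
      omega
    · exact h
    · have := hsep y hy x hx h
      omega

/-- A permutation of length `(n+1)d+1` is a maximum packing exactly when its first block is a
match and its tail is a maximum packing. -/
lemma mch_eq_succ_iff {d n : ℕ} (hd : 0 < d) {τ : Equiv.Perm (Fin (d + 1))}
    (hτ : MinOverlapping τ) {σ : Equiv.Perm (Fin ((n + 1) * d + 1))}
    {ρ : Equiv.Perm (Fin (n * d + 1))} (hρ : MatchAt ρ σ d) :
    mch τ σ = n + 1 ↔ MatchAt τ σ 0 ∧ mch τ ρ = n := by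
  have hM : (n + 1) * d = n * d + d := by ring
  set S := (Finset.range ((n + 1) * d + 1)).filter fun i => MatchAt τ σ i with hS
  have hmem : ∀ x, x ∈ S ↔ MatchAt τ σ x := fun x => by
    rw [hS, Finset.mem_filter, Finset.mem_range, and_iff_right_iff_imp]
    intro h
    have := ((matchAt_iff _ _ _).mp h).1
    omega
  have hle : ∀ x ∈ S, x ≤ n * d := fun x hx => by
    have := ((matchAt_iff _ _ _).mp ((hmem x).mp hx)).1
    omega
  have hsep : ∀ x ∈ S, ∀ y ∈ S, x < y → x + d ≤ y := fun x hx y hy =>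
    hτ.add_le ((hmem x).mp hx) ((hmem y).mp hy)
  have key : MatchAt τ σ 0 → S.card = mch τ ρ + 1 := by
    intro h0
    have h0S := (hmem 0).mpr h0
    rw [← Finset.card_erase_add_one h0S]
    congr 1
    rw [mch]
    symm
    refine Finset.card_nbij (fun l => d + l) (fun l hl => ?_) (fun a _ b _ hab => ?_)
      (fun x hx => ?_)
    · have hl := (Finset.mem_filter.mp hl).2
      have hl' := ((matchAt_iff _ _ _).mp hl).1
      change d + l ∈ S.erase 0
      exact Finset.mem_erase.mpr ⟨by omega, (hmem _).mpr ((matchAt_window τ hρ hl').mp hl)⟩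
    · simpa using hab
    · obtain ⟨hx0, hxS⟩ := Finset.mem_erase.mp (Finset.mem_coe.mp hx)
      have h1 := hsep 0 h0S x hxS (by omega)
      have h2 := hle x hxS
      refine ⟨x - d, Finset.mem_coe.mpr (Finset.mem_filter.mpr
        ⟨Finset.mem_range.mpr (by omega), (matchAt_window τ hρ (by omega)).mpr ?_⟩), ?_⟩
      · rw [show d + (x - d) = x by omega]
        exact (hmem x).mp hxS
      · simp only
        omega
  change S.card = n + 1 ↔ _
  constructor
  · intro h
    have h0 : MatchAt τ σ 0 := by
      by_contra h0
      have : S.card ≤ n := card_le_of_separated (c := 1) hsep fun x hx => by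
        have hx0 : x ≠ 0 := by
          rintro rfl
          exact h0 ((hmem 0).mp hx)
        have := hle x hx
        omega
      omega
    have := key h0
    exact ⟨h0, by omega⟩
  · rintro ⟨h0, h⟩
    rw [key h0, h]

lemma word_zero_of_mch {d : ℕ} (hd : 0 < d) {τ : Equiv.Perm (Fin (d + 1))}
    (hτ : MinOverlapping τ) (hfirst : word τ 0 = 0) (n : ℕ)
    (σ : Equiv.Perm (Fin (n * d + 1))) (hσ : mch τ σ = n) : word σ 0 = 0 := by
  induction n with
  | zero =>
    have := word_lt σ (i := 0) (by omega)
    omega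
  | succ n ih =>
    have hM : (n + 1) * d = n * d + d := by ring
    obtain ⟨ρ, hρ⟩ := exists_matchAt (m := n * d + 1) (c := d) σ (by omega)
    obtain ⟨h0, hn⟩ := (mch_eq_succ_iff hd hτ hρ).mp hσ
    have hρ0 := ih ρ hn
    rw [matchAt_iff] at hρ h0
    have hpos : ∀ a, a ≠ 0 → a ≤ d → word σ 0 < word σ a := fun a ha had => by
      have h1 := (h0.2 0 (by omega) a (by omega)).mp (by
        rw [hfirst]
        refine Nat.pos_of_ne_zero fun h => ha ?_
        exact word_inj τ (by omega) (by omega) (h.trans hfirst.symm))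
      simpa using h1
    obtain ⟨i, hi, hi0⟩ := word_surj σ (v := 0) (by omega)
    rcases Nat.lt_or_ge d i with h | h
    · have h1 := (hρ.2 0 (by omega) (i - d) (by omega)).mp (by
        rw [hρ0]
        refine Nat.pos_of_ne_zero fun h' => ?_
        have := word_inj ρ (by omega) (by omega) (h'.trans hρ0.symm)
        omega)
      rw [show d + (i - d) = i by omega] at h1
      omega
    · by_cases hi' : i = 0
      · rwa [hi'] at hi0
      · have := hpos i hi' h
        omega

lemma pqInt_add {K : Type} [CommSemiring K] (p q : K) (a b : ℕ) :
    pqInt p q (a + b) = p ^ a * pqInt p q b + q ^ b * pqInt p q a := by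
  simp only [pqInt]
  rw [add_comm a b, Finset.sum_range_add, Finset.mul_sum, Finset.mul_sum]
  congr 1
  · refine Finset.sum_congr rfl fun i hi => ?_
    have := Finset.mem_range.mp hi
    rw [← mul_assoc, ← pow_add]
    congr 2
    omega
  · refine Finset.sum_congr rfl fun i hi => ?_
    rw [mul_left_comm, ← pow_add]
    congr 2
    omega

lemma map_pqFact {R S : Type} [CommSemiring R] [CommSemiring S] (f : R →+* S) (p q : R) (n : ℕ) :
    f (pqFact p q n) = pqFact (f p) (f q) n := by
  induction n with
  | zero => simp [pqFact]
  | succ n ih => simp [pqFact, pqInt, ih]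

lemma pqFact_one_one (n : ℕ) : pqFact (1 : ℚ) 1 n = (n.factorial : ℚ) := by
  induction n with
  | zero => simp [pqFact]
  | succ n ih => simp [pqFact, pqInt, ih, Nat.factorial_succ, mul_comm]

lemma pqFact_ne_zero (n : ℕ) : pqFact pW qW n ≠ 0 := by
  rw [pW, qW, ← map_pqFact]
  intro h
  have h0 : pqFact (MvPolynomial.X 0 : MvPolynomial (Fin 2) ℚ) (MvPolynomial.X 1) n = 0 :=
    (map_eq_zero_iff _ (IsFractionRing.injective (MvPolynomial (Fin 2) ℚ) K2)).mp h
  have h1 := congrArg (MvPolynomial.eval (fun _ : Fin 2 => (1 : ℚ))) h0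
  rw [map_pqFact, MvPolynomial.eval_X, MvPolynomial.eval_X, pqFact_one_one, map_zero] at h1
  exact Nat.factorial_ne_zero n (by exact_mod_cast h1)

/-- The number of pairs in `A × B` related by `r`. -/
def cross (r : ℕ → ℕ → Prop) (A B : Finset ℕ) : ℕ :=
  ((A ×ˢ B).filter fun q => r q.1 q.2).card

lemma cross_union_left (r : ℕ → ℕ → Prop) {A A' : Finset ℕ} (B : Finset ℕ) (h : Disjoint A A') :
    cross r (A ∪ A') B = cross r A B + cross r A' B := by
  rw [cross, Finset.union_product, Finset.filter_union, Finset.card_union_of_disjoint]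
  · rfl
  · exact Finset.disjoint_filter_filter (Finset.disjoint_product.mpr (Or.inl h))

lemma cross_union_right (r : ℕ → ℕ → Prop) (A : Finset ℕ) {B B' : Finset ℕ} (h : Disjoint B B') :
    cross r A (B ∪ B') = cross r A B + cross r A B' := by
  rw [cross, Finset.product_union, Finset.filter_union, Finset.card_union_of_disjoint]
  · rfl
  · exact Finset.disjoint_filter_filter (Finset.disjoint_product.mpr (Or.inr h))

lemma cross_eq_mul {r : ℕ → ℕ → Prop} {A B : Finset ℕ} (h : ∀ a ∈ A, ∀ b ∈ B, r a b) :
    cross r A B = A.card * B.card := by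
  rw [cross, Finset.filter_true_of_mem, Finset.card_product]
  exact fun q hq => h _ (Finset.mem_product.mp hq).1 _ (Finset.mem_product.mp hq).2

lemma cross_eq_zero {r : ℕ → ℕ → Prop} {A B : Finset ℕ} (h : ∀ a ∈ A, ∀ b ∈ B, ¬ r a b) :
    cross r A B = 0 := by
  rw [cross, Finset.card_eq_zero, Finset.filter_eq_empty_iff]
  exact fun q hq => h _ (Finset.mem_product.mp hq).1 _ (Finset.mem_product.mp hq).2

lemma cross_image (r : ℕ → ℕ → Prop) {f : ℕ → ℕ} {P Q : Finset ℕ}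
    (hP : Set.InjOn f P) (hQ : Set.InjOn f Q) :
    cross r (P.image f) (Q.image f) = cross (fun i k => r (f i) (f k)) P Q := by
  symm
  refine Finset.card_nbij (fun q => (f q.1, f q.2)) (fun q hq => ?_) (fun x hx y hy hxy => ?_)
    (fun z hz => ?_)
  · obtain ⟨hq, hr⟩ := Finset.mem_filter.mp hq
    obtain ⟨h1, h2⟩ := Finset.mem_product.mp hq
    exact Finset.mem_filter.mpr ⟨Finset.mem_product.mpr
      ⟨Finset.mem_image_of_mem f h1, Finset.mem_image_of_mem f h2⟩, hr⟩
  · simp only [Finset.coe_filter, Finset.mem_product, Set.mem_ofPred_eq] at hx hy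
    simp only [Prod.mk.injEq] at hxy
    exact Prod.ext (hP hx.1.1 hy.1.1 hxy.1) (hQ hx.1.2 hy.1.2 hxy.2)
  · simp only [Finset.coe_filter, Finset.mem_product, Set.mem_ofPred_eq, Finset.mem_image] at hz
    obtain ⟨⟨⟨a, ha, hfa⟩, b, hb, hfb⟩, hr⟩ := hz
    refine ⟨(a, b), ?_, Prod.ext hfa hfb⟩
    simp only [Finset.coe_filter, Finset.mem_product, Set.mem_ofPred_eq, hfa, hfb]
    exact ⟨⟨ha, hb⟩, hr⟩

/-- The weight `q^{#(x > y)} p^{#(x < y)}` of the pairs `(x, y) ∈ A × B`. -/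
def shuffleWeight {K : Type} [CommSemiring K] (p q : K) (A B : Finset ℕ) : K :=
  q ^ cross (fun x y => y < x) A B * p ^ cross (fun x y => x < y) A B

lemma shuffleWeight_union_left {K : Type} [CommSemiring K] (p q : K) {A A' : Finset ℕ}
    (B : Finset ℕ) (h : Disjoint A A') :
    shuffleWeight p q (A ∪ A') B = shuffleWeight p q A B * shuffleWeight p q A' B := by
  rw [shuffleWeight, cross_union_left _ _ h, cross_union_left _ _ h, shuffleWeight, shuffleWeight,
    pow_add, pow_add]
  ring

lemma shuffleWeight_union_right {K : Type} [CommSemiring K] (p q : K) (A : Finset ℕ)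
    {B B' : Finset ℕ} (h : Disjoint B B') :
    shuffleWeight p q A (B ∪ B') = shuffleWeight p q A B * shuffleWeight p q A B' := by
  rw [shuffleWeight, cross_union_right _ _ h, cross_union_right _ _ h, shuffleWeight,
    shuffleWeight, pow_add, pow_add]
  ring

lemma shuffleWeight_of_lt {K : Type} [CommSemiring K] (p q : K) {A B : Finset ℕ}
    (h : ∀ a ∈ A, ∀ b ∈ B, a < b) : shuffleWeight p q A B = p ^ (A.card * B.card) := by
  rw [shuffleWeight, cross_eq_mul h, cross_eq_zero fun a ha b hb => (h a ha b hb).asymm, pow_zero,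
    one_mul]

lemma shuffleWeight_of_gt {K : Type} [CommSemiring K] (p q : K) {A B : Finset ℕ}
    (h : ∀ a ∈ A, ∀ b ∈ B, b < a) : shuffleWeight p q A B = q ^ (A.card * B.card) := by
  rw [shuffleWeight, cross_eq_mul h, cross_eq_zero fun a ha b hb => (h a ha b hb).asymm, pow_zero,
    mul_one]

lemma Ico_sdiff_insert_top {c m : ℕ} {A : Finset ℕ} :
    Finset.Ico c (c + (m + 1)) \ insert (c + m) A = Finset.Ico c (c + m) \ A := by
  ext x
  simp only [Finset.mem_sdiff, Finset.mem_Ico, Finset.mem_insert]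
  constructor
  · rintro ⟨h1, h2⟩
    exact ⟨by omega, fun h => h2 (Or.inr h)⟩
  · rintro ⟨h1, h2⟩
    refine ⟨by omega, ?_⟩
    rintro (h | h)
    · omega
    · exact h2 h

lemma Ico_succ_top_sdiff {c m : ℕ} {A : Finset ℕ} (hA : A ⊆ Finset.Ico c (c + m)) :
    Finset.Ico c (c + (m + 1)) \ A = (Finset.Ico c (c + m) \ A) ∪ {c + m} := by
  ext x
  have := @hA (c + m)
  simp only [Finset.mem_sdiff, Finset.mem_Ico, Finset.mem_union, Finset.mem_singleton] at *
  constructor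
  · rintro ⟨h1, h2⟩
    by_cases hx : x = c + m
    · exact Or.inr hx
    · exact Or.inl ⟨by omega, h2⟩
  · rintro (⟨h1, h2⟩ | rfl)
    · exact ⟨by omega, h2⟩
    · exact ⟨by omega, fun h => by have := this h; omega⟩

/-- The generating function of the `a`-element subsets of an interval of length `m`. -/
def subsetSum {K : Type} [CommSemiring K] (p q : K) (c m a : ℕ) : K :=
  ∑ A ∈ Finset.powersetCard a (Finset.Ico c (c + m)),
    shuffleWeight p q A (Finset.Ico c (c + m) \ A)

lemma subsetSum_zero {K : Type} [CommSemiring K] (p q : K) (c m : ℕ) :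
    subsetSum p q c m 0 = 1 := by
  simp [subsetSum, shuffleWeight, cross]

lemma subsetSum_self {K : Type} [CommSemiring K] (p q : K) (c m : ℕ) :
    subsetSum p q c m m = 1 := by
  have h : Finset.powersetCard m (Finset.Ico c (c + m)) = {Finset.Ico c (c + m)} := by
    have := Finset.powersetCard_self (Finset.Ico c (c + m))
    rwa [Nat.card_Ico, Nat.add_sub_cancel_left] at this
  rw [subsetSum, h]
  simp [shuffleWeight, cross]

lemma subsetSum_pascal {K : Type} [CommSemiring K] (p q : K) (c a b : ℕ) :
    subsetSum p q c (a + b + 1) (a + 1) =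
      q ^ b * subsetSum p q c (a + b) a + p ^ (a + 1) * subsetSum p q c (a + b) (a + 1) := by
  have hIco : Finset.Ico c (c + (a + b + 1)) =
      insert (c + (a + b)) (Finset.Ico c (c + (a + b))) := by
    ext x
    simp only [Finset.mem_Ico, Finset.mem_insert]
    omega
  have hnot : c + (a + b) ∉ Finset.Ico c (c + (a + b)) := by simp
  have hpow : Finset.powersetCard (a + 1) (Finset.Ico c (c + (a + b + 1))) =
      Finset.powersetCard (a + 1) (Finset.Ico c (c + (a + b))) ∪
        (Finset.powersetCard a (Finset.Ico c (c + (a + b)))).image (insert (c + (a + b))) := by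
    rw [hIco, Finset.powersetCard_succ_insert hnot]
  have hsub : ∀ {k : ℕ} {A : Finset ℕ}, A ∈ Finset.powersetCard k (Finset.Ico c (c + (a + b))) →
      A ⊆ Finset.Ico c (c + (a + b)) ∧ A.card = k := fun h => Finset.mem_powersetCard.mp h
  rw [subsetSum, hpow, Finset.sum_union, Finset.sum_image, add_comm]
  · congr 1
    · rw [subsetSum, Finset.mul_sum]
      refine Finset.sum_congr rfl fun A hA => ?_
      obtain ⟨hA1, hA2⟩ := hsub hA
      rw [Ico_sdiff_insert_top, Finset.insert_eq, shuffleWeight_union_left, shuffleWeight_of_gt]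
      · rw [Finset.card_sdiff_of_subset hA1, hA2]
        simp
      · intro x hx y hy
        simp only [Finset.mem_singleton, Finset.mem_sdiff, Finset.mem_Ico] at hx hy
        omega
      · exact Finset.disjoint_singleton_left.mpr fun h => hnot (hA1 h)
    · rw [subsetSum, Finset.mul_sum]
      refine Finset.sum_congr rfl fun A hA => ?_
      obtain ⟨hA1, hA2⟩ := hsub hA
      rw [Ico_succ_top_sdiff hA1, shuffleWeight_union_right, mul_comm]
      · rw [shuffleWeight_of_lt (B := {c + (a + b)}), hA2]
        · simp
        · intro x hx y hy
          have := Finset.mem_Ico.mp (hA1 hx)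
          rw [Finset.mem_singleton.mp hy]
          exact this.2
      · exact Finset.disjoint_singleton_right.mpr fun h =>
          hnot (Finset.mem_sdiff.mp h).1
  · intro A hA B hB hAB
    have hA' : c + (a + b) ∉ A := fun h => hnot ((hsub hA).1 h)
    have hB' : c + (a + b) ∉ B := fun h => hnot ((hsub hB).1 h)
    rw [← Finset.erase_insert hA', ← Finset.erase_insert hB', hAB]
  · rw [Finset.disjoint_left]
    intro A hA hA'
    obtain ⟨B, -, rfl⟩ := Finset.mem_image.mp hA'
    exact hnot ((hsub hA).1 (Finset.mem_insert_self _ _))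

lemma subsetSum_mul_pqFact {K : Type} [CommSemiring K] (p q : K) (c m : ℕ) : ∀ a b : ℕ,
    a + b = m → subsetSum p q c m a * (pqFact p q a * pqFact p q b) = pqFact p q m := by
  induction m with
  | zero =>
    intro a b h
    obtain ⟨rfl, rfl⟩ : a = 0 ∧ b = 0 := by omega
    simp [subsetSum_zero, pqFact]
  | succ m ih =>
    intro a b h
    rcases a with - | a
    · obtain rfl : b = m + 1 := by omega
      simp [subsetSum_zero, pqFact]
    rcases b with - | b
    · obtain rfl : a = m := by omega
      simp [subsetSum_self, pqFact]
    obtain rfl : m = a + (b + 1) := by omega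
    rw [subsetSum_pascal]
    have h1 := ih a (b + 1) rfl
    have h2 := ih (a + 1) b (by omega)
    have h3 := pqInt_add p q (a + 1) (b + 1)
    calc _ = q ^ (b + 1) * pqInt p q (a + 1) * (subsetSum p q c (a + (b + 1)) a *
          (pqFact p q a * pqFact p q (b + 1))) + p ^ (a + 1) * pqInt p q (b + 1) *
          (subsetSum p q c (a + (b + 1)) (a + 1) * (pqFact p q (a + 1) * pqFact p q b)) := by
          simp only [pqFact]; ring
      _ = pqFact p q (a + (b + 1)) * pqInt p q ((a + 1) + (b + 1)) := by
          rw [h1, h2, h3]; ring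
      _ = _ := by
          rw [show (a + 1) + (b + 1) = a + (b + 1) + 1 by omega]
          rfl

lemma subsetSum_eq_pqBinom (c : ℕ) {m a : ℕ} (h : a ≤ m) :
    subsetSum pW qW c m a = pqBinom pW qW m a := by
  rw [pqBinom, if_pos h, eq_div_iff (mul_ne_zero (pqFact_ne_zero _) (pqFact_ne_zero _))]
  exact subsetSum_mul_pqFact pW qW c m a (m - a) (by omega)

/-- The number of pairs of positions `i < k < n` with `r (f i) (f k)`. -/
def pairCount (r : ℕ → ℕ → Prop) (f : ℕ → ℕ) (n : ℕ) : ℕ :=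
  ((Finset.range n ×ˢ Finset.range n).filter fun q => q.1 < q.2 ∧ r (f q.1) (f q.2)).card

lemma card_filter_fin_eq_pairCount {n : ℕ} (r : ℕ → ℕ → Prop) (σ : Equiv.Perm (Fin n)) :
    (Finset.univ.filter fun q : Fin n × Fin n => q.1 < q.2 ∧ r (σ q.1) (σ q.2)).card =
      pairCount r (word σ) n := by
  refine Finset.card_nbij (fun q => ((q.1 : ℕ), (q.2 : ℕ))) (fun q hq => ?_)
    (fun x _ y _ hxy => ?_) (fun z hz => ?_)
  · refine Finset.mem_filter.mpr ⟨Finset.mem_product.mpr ⟨Finset.mem_range.mpr q.1.isLt,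
      Finset.mem_range.mpr q.2.isLt⟩, ?_⟩
    rw [word_val, word_val]
    exact (Finset.mem_filter.mp hq).2
  · simp only [Prod.mk.injEq] at hxy
    exact Prod.ext (Fin.ext hxy.1) (Fin.ext hxy.2)
  · obtain ⟨hz1, hz2⟩ := Finset.mem_filter.mp (Finset.mem_coe.mp hz)
    obtain ⟨h1, h2⟩ := Finset.mem_product.mp hz1
    have h1 := Finset.mem_range.mp h1
    have h2 := Finset.mem_range.mp h2
    refine ⟨(⟨z.1, h1⟩, ⟨z.2, h2⟩), ?_, rfl⟩
    refine Finset.mem_coe.mpr (Finset.mem_filter.mpr ⟨Finset.mem_univ _, hz2.1, ?_⟩)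
    have := hz2.2
    rwa [word_of_lt σ h1, word_of_lt σ h2] at this

lemma inv_eq_pairCount {n : ℕ} (σ : Equiv.Perm (Fin n)) :
    inv σ = pairCount (fun x y => y < x) (word σ) n := by
  rw [inv, ← card_filter_fin_eq_pairCount]
  congr 1
  ext q
  simp

lemma coinv_eq_pairCount {n : ℕ} (σ : Equiv.Perm (Fin n)) :
    coinv σ = pairCount (fun x y => x < y) (word σ) n := by
  rw [coinv, ← card_filter_fin_eq_pairCount]
  congr 1
  ext q
  simp

lemma pairCount_glue {r : ℕ → ℕ → Prop} {d N : ℕ} {f t g : ℕ → ℕ}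
    (ht : ∀ a ≤ d, ∀ b ≤ d, (r (f a) (f b) ↔ r (t a) (t b)))
    (hg : ∀ a < N, ∀ b < N, (r (f (d + a)) (f (d + b)) ↔ r (g a) (g b))) (hN : 0 < N) :
    pairCount r f (d + N) = pairCount r t (d + 1) + pairCount r g N +
      cross (fun i k => r (f i) (f k)) (Finset.range d) (Finset.Ico (d + 1) (d + N)) := by
  have h1 : pairCount r t (d + 1) = pairCount r f (d + 1) := by
    refine congrArg Finset.card (Finset.filter_congr fun q hq => ?_)
    simp only [Finset.mem_product, Finset.mem_range] at hq
    rw [ht q.1 (by omega) q.2 (by omega)]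
  have h2 : pairCount r g N = ((Finset.Ico d (d + N) ×ˢ Finset.Ico d (d + N)).filter
      fun q => q.1 < q.2 ∧ r (f q.1) (f q.2)).card := by
    refine Finset.card_nbij (fun q => (d + q.1, d + q.2)) (fun q hq => ?_)
      (fun x _ y _ hxy => ?_) (fun z hz => ?_)
    · obtain ⟨hq, hlt, hr⟩ := Finset.mem_filter.mp hq
      simp only [Finset.mem_product, Finset.mem_range] at hq
      refine Finset.mem_filter.mpr ⟨?_, by simpa using hlt, (hg _ hq.1 _ hq.2).mpr hr⟩
      simp only [Finset.mem_product, Finset.mem_Ico]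
      omega
    · simp only [Prod.mk.injEq] at hxy
      exact Prod.ext (by omega) (by omega)
    · obtain ⟨hz, hlt, hr⟩ := Finset.mem_filter.mp (Finset.mem_coe.mp hz)
      simp only [Finset.mem_product, Finset.mem_Ico] at hz
      have e1 : d + (z.1 - d) = z.1 := by omega
      have e2 : d + (z.2 - d) = z.2 := by omega
      refine ⟨(z.1 - d, z.2 - d), Finset.mem_coe.mpr (Finset.mem_filter.mpr ⟨?_, ?_, ?_⟩),
        Prod.ext e1 e2⟩
      · simp only [Finset.mem_product, Finset.mem_range]
        omega
      · simp only
        omega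
      · rw [← hg _ (by simp only; omega) _ (by simp only; omega)]
        simpa only [e1, e2] using hr
  rw [h1, h2, pairCount, pairCount, cross, ← Finset.card_union_of_disjoint,
    ← Finset.card_union_of_disjoint]
  · congr 1
    ext q
    simp only [Finset.mem_union, Finset.mem_filter, Finset.mem_product, Finset.mem_range,
      Finset.mem_Ico]
    constructor
    · rintro ⟨hq, hlt, hr⟩
      simp only [hlt, hr, and_true]
      omega
    · rintro ((⟨hq, hlt, hr⟩ | ⟨hq, hlt, hr⟩) | ⟨hq, hr⟩)
      · exact ⟨by omega, hlt, hr⟩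
      · exact ⟨by omega, hlt, hr⟩
      · exact ⟨by omega, by omega, hr⟩
  · rw [Finset.disjoint_left]
    intro q hq hq'
    simp only [Finset.mem_union, Finset.mem_filter, Finset.mem_product, Finset.mem_range,
      Finset.mem_Ico] at hq hq'
    omega
  · rw [Finset.disjoint_left]
    intro q hq hq'
    simp only [Finset.mem_filter, Finset.mem_product, Finset.mem_range,
      Finset.mem_Ico] at hq hq'
    omega

lemma exists_enum (A : Finset ℕ) :
    ∃ e : ℕ → ℕ, (∀ b < A.card, ∀ a < b, e a < e b) ∧ ∀ a < A.card, e a ∈ A := by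
  refine ⟨fun a => if h : a < A.card then A.orderEmbOfFin rfl ⟨a, h⟩ else 0, fun b hb a hab => ?_,
    fun a ha => ?_⟩
  · simp only [dif_pos hb, dif_pos (hab.trans hb)]
    exact (A.orderEmbOfFin rfl).strictMono hab
  · simp only [dif_pos ha]
    exact A.orderEmbOfFin_mem rfl _

/-- The values at least `s` in the first `d + 1` positions of `σ`. -/
def largeVals (d s : ℕ) {n : ℕ} (σ : Equiv.Perm (Fin n)) : Finset ℕ :=
  ((Finset.range (d + 1)).image (word σ)).filter (s ≤ ·)

section Glue

variable {d N M s : ℕ} {τ : Equiv.Perm (Fin (d + 1))} {ρ : Equiv.Perm (Fin N)}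
  {σ : Equiv.Perm (Fin M)}

lemma lt_word_of_glue (hM : M = d + N) (hρ : MatchAt ρ σ d) (hρ0 : word ρ 0 = 0) {k : ℕ}
    (hk : d < k) (hkM : k < M) : word σ d < word σ k := by
  have h1 := (((matchAt_iff _ _ _).mp hρ).2 0 (by omega) (k - d) (by omega)).mp (by
    rw [hρ0]
    refine Nat.pos_of_ne_zero fun h => ?_
    have := word_inj ρ (by omega) (by omega) (h.trans hρ0.symm)
    omega)
  rwa [show d + (k - d) = k by omega, add_zero] at h1

lemma word_lt_iff_of_glue (hτ : MatchAt τ σ 0) {a b : ℕ} (ha : a ≤ d) (hb : b ≤ d) :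
    word τ a < word τ b ↔ word σ a < word σ b := by
  have := ((matchAt_iff _ _ _).mp hτ).2 a (by omega) b (by omega)
  simpa using this

lemma word_last_of_glue (hM : M = d + N) (hN : 0 < N) (hlast : word τ d = s - 1)
    (hτ : MatchAt τ σ 0) (hρ : MatchAt ρ σ d) (hρ0 : word ρ 0 = 0) : word σ d = s - 1 := by
  have hsd := word_lt τ (i := d) (by omega)
  set P := (Finset.range (d + 1)).filter fun i => word τ i < s - 1 with hP
  have h1 : P.image (word τ) = Finset.range (s - 1) := by
    ext v
    simp only [hP, Finset.mem_image, Finset.mem_filter, Finset.mem_range]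
    constructor
    · rintro ⟨i, ⟨-, hi⟩, rfl⟩
      exact hi
    · intro hv
      obtain ⟨i, hi, rfl⟩ := word_surj τ (v := v) (by omega)
      exact ⟨i, ⟨hi, hv⟩, rfl⟩
  have h2 : P.image (word σ) = Finset.range (word σ d) := by
    ext v
    simp only [hP, Finset.mem_image, Finset.mem_filter, Finset.mem_range]
    constructor
    · rintro ⟨i, ⟨hi, hv⟩, rfl⟩
      rw [← hlast] at hv
      exact (word_lt_iff_of_glue hτ (by omega) le_rfl).mp hv
    · intro hv
      have := word_lt σ (i := d) (by omega)
      obtain ⟨i, hi, rfl⟩ := word_surj σ (v := v) (by omega)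
      have hid : i ≤ d := by
        by_contra h
        have := lt_word_of_glue hM hρ hρ0 (k := i) (by omega) hi
        omega
      refine ⟨i, ⟨by omega, ?_⟩, rfl⟩
      rw [← hlast]
      exact (word_lt_iff_of_glue hτ hid le_rfl).mpr hv
  have hc1 := Finset.card_image_of_injOn (s := P) (f := word τ) fun x hx y hy h =>
    word_inj τ (Finset.mem_range.mp (Finset.mem_filter.mp hx).1)
      (Finset.mem_range.mp (Finset.mem_filter.mp hy).1) h
  have hc2 := Finset.card_image_of_injOn (s := P) (f := word σ) fun x hx y hy h => by
    have hx := Finset.mem_range.mp (Finset.mem_filter.mp hx).1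
    have hy := Finset.mem_range.mp (Finset.mem_filter.mp hy).1
    exact word_inj σ (by omega) (by omega) h
  rw [h1, Finset.card_range] at hc1
  rw [h2, Finset.card_range] at hc2
  omega

lemma image_first_block (hM : M = d + N) (hN : 0 < N) (hs : 1 ≤ s)
    (hlast : word τ d = s - 1) (hτ : MatchAt τ σ 0) (hρ : MatchAt ρ σ d) (hρ0 : word ρ 0 = 0) :
    (Finset.range (d + 1)).image (word σ) = Finset.range s ∪ largeVals d s σ := by
  have hd := word_last_of_glue hM hN hlast hτ hρ hρ0
  have hdM := word_lt σ (i := d) (by omega)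
  ext v
  simp only [largeVals, Finset.mem_union, Finset.mem_filter, Finset.mem_range]
  constructor
  · intro h
    rcases Nat.lt_or_ge v s with hv | hv
    · exact Or.inl hv
    · exact Or.inr ⟨h, hv⟩
  · rintro (hv | ⟨h, -⟩)
    · obtain ⟨i, hi, rfl⟩ := word_surj σ (v := v) (by omega)
      refine Finset.mem_image_of_mem _ (Finset.mem_range.mpr ?_)
      by_contra h
      have := lt_word_of_glue hM hρ hρ0 (k := i) (by omega) hi
      omega
    · exact h

lemma disjoint_range_of_subset_Ico {s M : ℕ} {A : Finset ℕ} (hA : A ⊆ Finset.Ico s M) {k : ℕ}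
    (hk : k ≤ s) : Disjoint (Finset.range k) A := by
  rw [Finset.disjoint_left]
  intro x hx hxA
  have := Finset.mem_Ico.mp (hA hxA)
  have := Finset.mem_range.mp hx
  omega

lemma largeVals_subset (hdM : d + 1 ≤ M) : largeVals d s σ ⊆ Finset.Ico s M := by
  intro v hv
  obtain ⟨h1, h2⟩ := Finset.mem_filter.mp hv
  obtain ⟨i, hi, rfl⟩ := Finset.mem_image.mp h1
  have := Finset.mem_range.mp hi
  exact Finset.mem_Ico.mpr ⟨h2, word_lt σ (by omega)⟩

lemma card_largeVals (hM : M = d + N) (hN : 0 < N) (hs : 1 ≤ s)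
    (hlast : word τ d = s - 1) (hτ : MatchAt τ σ 0) (hρ : MatchAt ρ σ d) (hρ0 : word ρ 0 = 0) :
    (largeVals d s σ).card = d + 1 - s := by
  have h := congrArg Finset.card (image_first_block hM hN hs hlast hτ hρ hρ0)
  rw [Finset.card_union_of_disjoint
    (disjoint_range_of_subset_Ico (largeVals_subset (M := M) (by omega)) le_rfl),
    Finset.card_range, Finset.card_image_of_injOn, Finset.card_range] at h
  · omega
  · intro x hx y hy hxy
    have hx := Finset.mem_range.mp (Finset.mem_coe.mp hx)
    have hy := Finset.mem_range.mp (Finset.mem_coe.mp hy)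
    exact word_inj σ (by omega) (by omega) hxy

lemma image_range_of_glue (hM : M = d + N) (hN : 0 < N) (hs : 1 ≤ s)
    (hlast : word τ d = s - 1) (hτ : MatchAt τ σ 0) (hρ : MatchAt ρ σ d) (hρ0 : word ρ 0 = 0) :
    (Finset.range d).image (word σ) = Finset.range (s - 1) ∪ largeVals d s σ := by
  have hd := word_last_of_glue hM hN hlast hτ hρ hρ0
  have h := image_first_block hM hN hs hlast hτ hρ hρ0
  ext v
  have hv := Finset.ext_iff.mp h v
  simp only [Finset.mem_union, Finset.mem_image, Finset.mem_range] at hv ⊢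
  have hlv : v ∈ largeVals d s σ → s ≤ v := fun h => (Finset.mem_filter.mp h).2
  constructor
  · rintro ⟨i, hi, rfl⟩
    have hne : word σ i ≠ s - 1 := fun h => by
      have := word_inj σ (by omega) (by omega) (h.trans hd.symm)
      omega
    rcases hv.mp ⟨i, by omega, rfl⟩ with h | h
    · exact Or.inl (by omega)
    · exact Or.inr h
  · intro h'
    have h'' : v < s ∨ v ∈ largeVals d s σ := h'.imp (fun h => h.trans_le (Nat.sub_le s 1)) id
    obtain ⟨i, hi, rfl⟩ := hv.mpr h''
    refine ⟨i, ?_, rfl⟩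
    by_contra hid
    obtain rfl : i = d := by omega
    rcases h' with h' | h'
    · omega
    · have := hlv h'
      omega

lemma image_Ico_of_glue (hM : M = d + N) (hN : 0 < N) (hs : 1 ≤ s)
    (hlast : word τ d = s - 1) (hτ : MatchAt τ σ 0) (hρ : MatchAt ρ σ d) (hρ0 : word ρ 0 = 0) :
    (Finset.Ico (d + 1) (d + N)).image (word σ) = Finset.Ico s M \ largeVals d s σ := by
  have h := image_first_block hM hN hs hlast hτ hρ hρ0
  ext v
  have hv := Finset.ext_iff.mp h v
  simp only [Finset.mem_union, Finset.mem_image, Finset.mem_range] at hv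
  simp only [Finset.mem_image, Finset.mem_sdiff, Finset.mem_Ico]
  constructor
  · rintro ⟨i, hi, rfl⟩
    have hnot : ¬ ∃ a < d + 1, word σ a = word σ i := by
      rintro ⟨a, ha, hai⟩
      have := word_inj σ (by omega) (by omega) hai
      omega
    rw [hv, not_or] at hnot
    exact ⟨⟨by omega, word_lt σ (by omega)⟩, hnot.2⟩
  · rintro ⟨⟨h1, h2⟩, h3⟩
    obtain ⟨i, hi, rfl⟩ := word_surj σ h2
    refine ⟨i, ⟨?_, by omega⟩, rfl⟩
    by_contra hid
    rcases hv.mp ⟨i, by omega, rfl⟩ with h | h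
    · omega
    · exact h3 h

lemma image_tail_of_glue (hM : M = d + N) (hN : 0 < N) (hs : 1 ≤ s)
    (hlast : word τ d = s - 1) (hτ : MatchAt τ σ 0) (hρ : MatchAt ρ σ d) (hρ0 : word ρ 0 = 0) :
    (Finset.range N).image (fun a => word σ (d + a)) =
      insert (s - 1) (Finset.Ico s M \ largeVals d s σ) := by
  rw [← image_Ico_of_glue hM hN hs hlast hτ hρ hρ0,
    ← word_last_of_glue hM hN hlast hτ hρ hρ0, ← Finset.image_insert]
  ext v
  simp only [Finset.mem_image, Finset.mem_insert, Finset.mem_range, Finset.mem_Ico]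
  constructor
  · rintro ⟨a, ha, rfl⟩
    exact ⟨d + a, by omega, rfl⟩
  · rintro ⟨i, hi, rfl⟩
    refine ⟨i - d, by omega, ?_⟩
    rw [show d + (i - d) = i by omega]

lemma weight_of_glue {K : Type} [CommSemiring K] (p q : K) (hM : M = d + N) (hN : 0 < N)
    (hs : 1 ≤ s) (hlast : word τ d = s - 1) (hτ : MatchAt τ σ 0) (hρ : MatchAt ρ σ d)
    (hρ0 : word ρ 0 = 0) :
    q ^ inv σ * p ^ coinv σ = (p ^ coinv τ * q ^ inv τ * p ^ ((s - 1) * (N - 1))) *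
      (shuffleWeight p q (largeVals d s σ) (Finset.Ico s M \ largeVals d s σ) *
        (q ^ inv ρ * p ^ coinv ρ)) := by
  have hd := word_last_of_glue hM hN hlast hτ hρ hρ0
  have hsd := word_lt τ (i := d) (by omega)
  have hsub : largeVals d s σ ⊆ Finset.Ico s M := largeVals_subset (by omega)
  have hA := card_largeVals hM hN hs hlast hτ hρ hρ0
  have e1 := image_range_of_glue hM hN hs hlast hτ hρ hρ0
  have e2 := image_Ico_of_glue hM hN hs hlast hτ hρ hρ0
  have inj1 : Set.InjOn (word σ) (Finset.range d : Finset ℕ) := fun x hx y hy hxy => by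
    have hx := Finset.mem_range.mp (Finset.mem_coe.mp hx)
    have hy := Finset.mem_range.mp (Finset.mem_coe.mp hy)
    exact word_inj σ (by omega) (by omega) hxy
  have inj2 : Set.InjOn (word σ) (Finset.Ico (d + 1) (d + N) : Finset ℕ) :=
    fun x hx y hy hxy => by
      have hx := Finset.mem_Ico.mp (Finset.mem_coe.mp hx)
      have hy := Finset.mem_Ico.mp (Finset.mem_coe.mp hy)
      exact word_inj σ (by omega) (by omega) hxy
  have hw := shuffleWeight_union_left p q (Finset.Ico s M \ largeVals d s σ)
    (disjoint_range_of_subset_Ico hsub (Nat.sub_le s 1))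
  rw [shuffleWeight_of_lt (A := Finset.range (s - 1)), Finset.card_sdiff_of_subset hsub, hA,
    Nat.card_Ico, Finset.card_range, show M - s - (d + 1 - s) = N - 1 by omega, ← e1, ← e2,
    shuffleWeight, cross_image _ inj1 inj2, cross_image _ inj1 inj2, e2, ← hM] at hw
  · have hτ' := fun a ha b hb => word_lt_iff_of_glue hτ (a := a) (b := b) ha hb
    have hρ' := ((matchAt_iff _ _ _).mp hρ).2
    have h1 := pairCount_glue (r := fun x y => y < x) (f := word σ) (t := word τ) (g := word ρ)
      (fun a ha b hb => (hτ' b hb a ha).symm) (fun a ha b hb => (hρ' b hb a ha).symm) hN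
    have h2 := pairCount_glue (r := fun x y => x < y) (f := word σ) (t := word τ) (g := word ρ)
      (fun a ha b hb => (hτ' a ha b hb).symm) (fun a ha b hb => (hρ' a ha b hb).symm) hN
    rw [← hM, ← inv_eq_pairCount, ← inv_eq_pairCount, ← inv_eq_pairCount] at h1
    rw [← hM, ← coinv_eq_pairCount, ← coinv_eq_pairCount, ← coinv_eq_pairCount] at h2
    rw [h1, h2, pow_add, pow_add, pow_add, pow_add]
    calc _ = (q ^ inv τ * q ^ inv ρ * (p ^ coinv τ * p ^ coinv ρ)) * _ :=
          mul_mul_mul_comm _ _ _ _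
      _ = _ := by
          rw [hw]
          ring
  · intro x hx y hy
    have hx := Finset.mem_range.mp hx
    have hy := Finset.mem_Ico.mp (Finset.mem_sdiff.mp hy).1
    omega

lemma glue_unique {σ' : Equiv.Perm (Fin M)} (hM : M = d + N) (hN : 0 < N) (hs : 1 ≤ s)
    (hlast : word τ d = s - 1) (hτ : MatchAt τ σ 0) (hρ : MatchAt ρ σ d)
    (hτ' : MatchAt τ σ' 0) (hρ' : MatchAt ρ σ' d) (hρ0 : word ρ 0 = 0)
    (hA : largeVals d s σ = largeVals d s σ') : σ = σ' := by
  have h1 : ∀ a < d + 1, word σ a = word σ' a := by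
    refine eq_of_same_order (fun a ha b hb => ?_) ?_
    · rw [← word_lt_iff_of_glue hτ (by omega) (by omega),
        ← word_lt_iff_of_glue hτ' (by omega) (by omega)]
    · rw [image_first_block hM hN hs hlast hτ hρ hρ0,
        image_first_block hM hN hs hlast hτ' hρ' hρ0, hA]
  have h2 : ∀ a < N, word σ (d + a) = word σ' (d + a) := by
    refine eq_of_same_order (f := fun a => word σ (d + a)) (g := fun a => word σ' (d + a))
      (fun a ha b hb => ?_) ?_
    · rw [← ((matchAt_iff _ _ _).mp hρ).2 a ha b hb, ← ((matchAt_iff _ _ _).mp hρ').2 a ha b hb]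
    · rw [image_tail_of_glue hM hN hs hlast hτ hρ hρ0,
        image_tail_of_glue hM hN hs hlast hτ' hρ' hρ0, hA]
  refine word_ext fun i hi => ?_
  rcases Nat.lt_or_ge i (d + 1) with h | h
  · exact h1 i h
  · have := h2 (i - d) (by omega)
    rwa [show d + (i - d) = i by omega] at this

end Glue

lemma exists_glue {d N M s : ℕ} {τ : Equiv.Perm (Fin (d + 1))} {ρ : Equiv.Perm (Fin N)}
    (hM : M = d + N) (hN : 0 < N) (hs : 1 ≤ s) (hlast : word τ d = s - 1) (hρ0 : word ρ 0 = 0)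
    {A : Finset ℕ} (hA : A ⊆ Finset.Ico s M) (hcard : A.card = d + 1 - s) :
    ∃ σ : Equiv.Perm (Fin M), MatchAt τ σ 0 ∧ MatchAt ρ σ d ∧ largeVals d s σ = A := by
  have hsd := word_lt τ (i := d) (by omega)
  have hBcard : (Finset.Ico s M \ A).card = N - 1 := by
    rw [Finset.card_sdiff_of_subset hA, hcard, Nat.card_Ico]
    omega
  obtain ⟨eA, hA1, hA2⟩ := exists_enum A
  obtain ⟨eB, hB1, hB2⟩ := exists_enum (Finset.Ico s M \ A)
  rw [hcard] at hA1 hA2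
  rw [hBcard] at hB1 hB2
  have hA3 : ∀ a < d + 1 - s, s ≤ eA a ∧ eA a < M := fun a ha => Finset.mem_Ico.mp (hA (hA2 a ha))
  have hB3 : ∀ a < N - 1, s ≤ eB a ∧ eB a < M := fun a ha =>
    Finset.mem_Ico.mp (Finset.mem_sdiff.mp (hB2 a ha)).1
  have hB4 : ∀ a < N - 1, eB a ∉ A := fun a ha => (Finset.mem_sdiff.mp (hB2 a ha)).2
  obtain ⟨eC, heC⟩ : ∃ eC : ℕ → ℕ, eC = fun x => if x < s then x else eA (x - s) := ⟨_, rfl⟩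
  obtain ⟨eD, heD⟩ : ∃ eD : ℕ → ℕ, eD = fun y => if y = 0 then s - 1 else eB (y - 1) := ⟨_, rfl⟩
  have hC : ∀ y ≤ d, ∀ x < y, eC x < eC y := by
    intro y hy x hxy
    simp only [heC]
    split_ifs with h1 h2 h2
    · exact hxy
    · have := (hA3 (y - s) (by omega)).1
      omega
    · omega
    · exact hA1 _ (by omega) _ (by omega)
  have hD : ∀ y < N, ∀ x < y, eD x < eD y := by
    intro y hy x hxy
    simp only [heD]
    split_ifs with h1 h2 h2
    · omega
    · have := (hB3 (y - 1) (by omega)).1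
      omega
    · omega
    · exact hB1 _ (by omega) _ (by omega)
  have hC' : ∀ x ≤ d, ∀ y ≤ d, (x < y ↔ eC x < eC y) := fun x hx y hy => by
    rcases lt_trichotomy x y with h | rfl | h
    · exact iff_of_true h (hC y hy x h)
    · simp
    · exact iff_of_false (by omega) (hC x hx y h).asymm
  have hD' : ∀ x < N, ∀ y < N, (x < y ↔ eD x < eD y) := fun x hx y hy => by
    rcases lt_trichotomy x y with h | rfl | h
    · exact iff_of_true h (hD y hy x h)
    · simp
    · exact iff_of_false (by omega) (hD x hx y h).asymm
  have hCM : ∀ x ≤ d, eC x < M := fun x hx => by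
    simp only [heC]
    split_ifs with h
    · omega
    · exact (hA3 _ (by omega)).2
  have hDM : ∀ x < N, eD x < M := fun x hx => by
    simp only [heD]
    split_ifs with h
    · omega
    · exact (hB3 _ (by omega)).2
  have hCD : ∀ x ≤ d, ∀ y < N, 0 < y → eC x ≠ eD y := fun x hx y hy hy0 h => by
    simp only [heC, heD, if_neg hy0.ne'] at h
    split_ifs at h with hxs
    · have := (hB3 (y - 1) (by omega)).1
      omega
    · exact hB4 (y - 1) (by omega) (h ▸ hA2 (x - s) (by omega))
  have hτw : ∀ i ≤ d, word τ i ≤ d := fun i hi => by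
    have := word_lt τ (i := i) (by omega)
    omega
  have hρpos : ∀ i < N, 0 < i → 0 < word ρ i := fun i hi hi0 =>
    Nat.pos_of_ne_zero fun h => by
      have := word_inj ρ hi hN (h.trans hρ0.symm)
      omega
  obtain ⟨f, hf⟩ : ∃ f : ℕ → ℕ, f = fun i => if i ≤ d then eC (word τ i) else
    eD (word ρ (i - d)) := ⟨_, rfl⟩
  have hf1 : ∀ i ≤ d, f i = eC (word τ i) := fun i hi => by simp only [hf, if_pos hi]
  have hf2 : ∀ i < N, f (d + i) = eD (word ρ i) := fun i hi => by
    rcases Nat.eq_zero_or_pos i with rfl | hi0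
    · rw [hf1 _ (by omega), add_zero, hlast, hρ0]
      simp only [heC, heD, if_pos (show s - 1 < s by omega), if_true]
    · simp only [hf, if_neg (show ¬ d + i ≤ d by omega), Nat.add_sub_cancel_left]
  have hmix : ∀ i ≤ d, ∀ k < N, 0 < k → f i ≠ f (d + k) := fun i hi k hk hk0 => by
    rw [hf1 i hi, hf2 k hk]
    exact hCD _ (hτw i hi) _ (word_lt ρ hk) (hρpos k hk hk0)
  obtain ⟨σ, hσ⟩ := exists_perm_word_eq (n := M) f (fun i hi => by
    rcases Nat.lt_or_ge d i with h | h
    · obtain ⟨k, rfl⟩ := Nat.exists_eq_add_of_lt h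
      rw [add_assoc, hf2 _ (by omega)]
      exact hDM _ (word_lt ρ (by omega))
    · rw [hf1 i h]
      exact hCM _ (hτw i h)) (fun i hi k hk hik => by
    rcases Nat.lt_or_ge d i with h | h <;> rcases Nat.lt_or_ge d k with h' | h'
    · obtain ⟨a, rfl⟩ := Nat.exists_eq_add_of_le h.le
      obtain ⟨b, rfl⟩ := Nat.exists_eq_add_of_le h'.le
      rw [hf2 a (by omega), hf2 b (by omega)] at hik
      have ha := word_lt ρ (i := a) (by omega)
      have hb := word_lt ρ (i := b) (by omega)
      have h1 := hD' _ ha _ hb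
      have h2 := hD' _ hb _ ha
      rw [word_inj ρ (by omega) (by omega) (show word ρ a = word ρ b by omega)]
    · obtain ⟨a, rfl⟩ := Nat.exists_eq_add_of_le h.le
      exact absurd hik.symm (hmix k h' a (by omega) (by omega))
    · obtain ⟨b, rfl⟩ := Nat.exists_eq_add_of_le h'.le
      exact absurd hik (hmix i h b (by omega) (by omega))
    · rw [hf1 i h, hf1 k h'] at hik
      have h1 := hC' _ (hτw i h) _ (hτw k h')
      have h2 := hC' _ (hτw k h') _ (hτw i h)
      exact word_inj τ (by omega) (by omega) (by omega))
  have hτσ : MatchAt τ σ 0 := by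
    refine (matchAt_iff _ _ _).mpr ⟨by omega, fun a ha b hb => ?_⟩
    rw [zero_add, zero_add, hσ a (by omega), hσ b (by omega), hf1 a (by omega),
      hf1 b (by omega)]
    exact hC' _ (hτw a (by omega)) _ (hτw b (by omega))
  have hρσ : MatchAt ρ σ d := by
    refine (matchAt_iff _ _ _).mpr ⟨by omega, fun a ha b hb => ?_⟩
    rw [hσ _ (by omega), hσ _ (by omega), hf2 a ha, hf2 b hb]
    exact hD' _ (word_lt ρ ha) _ (word_lt ρ hb)
  refine ⟨σ, hτσ, hρσ, Finset.eq_of_subset_of_card_le (fun v hv => ?_) ?_⟩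
  · obtain ⟨h1, h2⟩ := Finset.mem_filter.mp hv
    obtain ⟨i, hi, rfl⟩ := Finset.mem_image.mp h1
    have hi := Finset.mem_range.mp hi
    have hti := hτw i (by omega)
    rw [hσ i (by omega), hf1 i (by omega)] at h2 ⊢
    simp only [heC] at h2 ⊢
    split_ifs at h2 ⊢ with h
    · omega
    · exact hA2 _ (by omega)
  · rw [hcard, card_largeVals hM hN hs hlast hτσ hρσ hρ0]

/-- Splitting a maximum packing into its first block and its tail. -/
lemma mpSum_succ {d s : ℕ} (hd : 0 < d) {τ : Equiv.Perm (Fin (d + 1))} (hτ : MinOverlapping τ)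
    (hs : 1 ≤ s) (hfirst : word τ 0 = 0) (hlast : word τ d = s - 1) (n : ℕ) {K : Type}
    [CommSemiring K] (p q : K) :
    mpSum τ (n + 1) p q = (p ^ coinv τ * q ^ inv τ * p ^ ((s - 1) * (n * d))) *
      subsetSum p q s ((n + 1) * d + 1 - s) (d + 1 - s) * mpSum τ n p q := by
  have hM : (n + 1) * d + 1 = d + (n * d + 1) := by ring
  have hsd := word_lt τ (i := d) (by omega)
  choose tail htail using fun σ : Equiv.Perm (Fin ((n + 1) * d + 1)) =>
    exists_matchAt (m := n * d + 1) (c := d) σ (by omega)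
  have hmp : ∀ σ, mch τ σ = n + 1 ↔ MatchAt τ σ 0 ∧ mch τ (tail σ) = n := fun σ =>
    mch_eq_succ_iff hd hτ (htail σ)
  have hzero : ∀ ρ : Equiv.Perm (Fin (n * d + 1)), mch τ ρ = n → word ρ 0 = 0 :=
    word_zero_of_mch hd hτ hfirst n
  rw [subsetSum, show s + ((n + 1) * d + 1 - s) = (n + 1) * d + 1 by omega, mul_assoc, mpSum,
    mpSum, Finset.sum_mul_sum, ← Finset.sum_product', Finset.mul_sum]
  refine Finset.sum_nbij (fun σ => (largeVals d s σ, tail σ)) (fun σ hσ => ?_)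
    (fun σ hσ σ' hσ' heq => ?_) (fun x hx => ?_) (fun σ hσ => ?_)
  · obtain ⟨h0, hn⟩ := (hmp σ).mp (Finset.mem_filter.mp hσ).2
    exact Finset.mem_product.mpr ⟨Finset.mem_powersetCard.mpr
      ⟨largeVals_subset (M := (n + 1) * d + 1) (by omega),
      card_largeVals hM (by omega) hs hlast h0 (htail σ) (hzero _ hn)⟩,
      Finset.mem_filter.mpr ⟨Finset.mem_univ _, hn⟩⟩
  · obtain ⟨h0, hn⟩ := (hmp σ).mp (Finset.mem_filter.mp (Finset.mem_coe.mp hσ)).2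
    obtain ⟨h0', hn'⟩ := (hmp σ').mp (Finset.mem_filter.mp (Finset.mem_coe.mp hσ')).2
    simp only [Prod.mk.injEq] at heq
    have ht := htail σ'
    rw [← heq.2] at ht
    exact glue_unique hM (by omega) hs hlast h0 (htail σ) h0' ht (hzero _ hn) heq.1
  · obtain ⟨h1, h2⟩ := Finset.mem_product.mp (Finset.mem_coe.mp hx)
    obtain ⟨hsub, hcard⟩ := Finset.mem_powersetCard.mp h1
    have hn := (Finset.mem_filter.mp h2).2
    obtain ⟨σ, h0, hρ, hA⟩ := exists_glue hM (by omega) hs hlast (hzero _ hn) hsub hcard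
    have ht : tail σ = x.2 := matchAt_unique (htail σ) hρ
    refine ⟨σ, Finset.mem_coe.mpr (Finset.mem_filter.mpr ⟨Finset.mem_univ _, ?_⟩),
      Prod.ext hA ht⟩
    exact (hmp σ).mpr ⟨h0, ht ▸ hn⟩
  · obtain ⟨h0, hn⟩ := (hmp σ).mp (Finset.mem_filter.mp hσ).2
    exact weight_of_glue p q hM (by omega) hs hlast h0 (htail σ) (hzero _ hn)

lemma mpSum_zero {d : ℕ} (hd : 0 < d) (τ : Equiv.Perm (Fin (d + 1))) {K : Type}
    [CommSemiring K] (p q : K) : mpSum τ 0 p q = 1 := by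
  have hcard : ∀ σ : Equiv.Perm (Fin (0 * (d + 1 - 1) + 1)), mch τ σ = 0 := fun σ => by
    rw [mch, Finset.card_eq_zero, Finset.filter_eq_empty_iff]
    intro i _ hi
    have := ((matchAt_iff _ _ _).mp hi).1
    omega
  have hfin : ∀ a b : Fin (0 * (d + 1 - 1) + 1), ¬ a < b := fun a b h => by
    have := b.isLt
    have := Fin.lt_def.mp h
    omega
  have : Unique (Equiv.Perm (Fin (0 * (d + 1 - 1) + 1))) :=
    { default := 1, uniq := fun σ => word_ext fun i hi => by
        have h1 := word_lt σ hi
        have h2 := word_lt 1 hi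
        omega }
  rw [mpSum, Finset.filter_true_of_mem fun σ _ => hcard σ, Fintype.sum_unique]
  simp [inv, coinv, hfin]

/-- Theorem (Duane–Remmel): if `τ ∈ S_j` (`j ≥ 3`) is minimal overlapping with
`τ_1 = 1` and `τ_j = s` where `2 ≤ s < j`, then for all `n ≥ 0`,
`mp_{τ,(n+1)(j-1)+1}(p,q) = (p^{coinv τ} q^{inv τ})^{n+1} p^{(s-1)(j-1)C(n+1,2)}
  Π_{i=1}^{n+1} [i(j-1)+1-s choose j-s]_{p,q}`. -/
theorem stmt2 {j : ℕ} (hj : 3 ≤ j) (τ : Equiv.Perm (Fin j)) (hτ : MinOverlapping τ)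
    (s : ℕ) (hs2 : 2 ≤ s) (hsj : s < j)
    (hfirst : τ ⟨0, by omega⟩ = ⟨0, by omega⟩)
    (hlast : τ ⟨j - 1, by omega⟩ = ⟨s - 1, by omega⟩) :
    ∀ n : ℕ,
      mpSum τ (n + 1) pW qW =
        (pW ^ coinv τ * qW ^ inv τ) ^ (n + 1) *
          pW ^ ((s - 1) * (j - 1) * Nat.choose (n + 1) 2) *
          ∏ i ∈ Finset.Icc 1 (n + 1), pqBinom pW qW (i * (j - 1) + 1 - s) (j - s) := by
  obtain ⟨d, rfl⟩ : ∃ d, j = d + 1 := ⟨j - 1, by omega⟩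
  have hword : ∀ i (hi : i < d + 1), word τ i = (τ ⟨i, hi⟩ : ℕ) := fun i hi => word_of_lt τ hi
  have h0 : word τ 0 = 0 := by rw [hword 0 (by omega), hfirst]
  have h1 : word τ d = s - 1 := by
    rw [hword d (by omega)]
    exact congrArg Fin.val hlast
  have hrec : ∀ n, mpSum τ (n + 1) pW qW =
      (pW ^ coinv τ * qW ^ inv τ * pW ^ ((s - 1) * (n * d))) *
        pqBinom pW qW ((n + 1) * d + 1 - s) (d + 1 - s) * mpSum τ n pW qW := fun n => by
    rw [mpSum_succ (by omega) hτ (by omega) h0 h1, subsetSum_eq_pqBinom]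
    have : (n + 1) * d = n * d + d := by ring
    omega
  intro n
  rw [Nat.add_sub_cancel]
  induction n with
  | zero =>
    rw [hrec, mpSum_zero (by omega)]
    simp
  | succ n ih =>
    have hc : (s - 1) * d * Nat.choose (n + 1 + 1) 2 =
        (s - 1) * d * Nat.choose (n + 1) 2 + (s - 1) * ((n + 1) * d) := by
      rw [Nat.choose_succ_succ' (n + 1) 1, Nat.choose_one_right]
      ring
    rw [hrec, ih, Finset.prod_Icc_succ_top (a := 1) (b := n + 1) (by omega), hc,
      pow_add _ _ ((s - 1) * ((n + 1) * d)), pow_succ _ (n + 1)]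
    ring

end CWilf
end
end

section
/- Suppose j ≥ 3 and α = α_1⋯α_j and β = β_1⋯β_j are minimal overlapping permutations in S_j with α_1 = β_1 and α_j = β_j. Then for all n ≥ 1, mp_{α,n(j−1)+1} = mp_{β,n(j−1)+1}, i.e. the number of maximum packings for α of length n(j−1)+1 equals the number of maximum packings for β of that length. -/
open scoped Classical

noncomputable section

namespace CWilf

/-- Every injective word over a linear order has a reduction. -/
lemma exists_perm_lt_iff_of_injective {L n : ℕ} (f : Fin L → Fin n)
    (hf : Function.Injective f) :
    ∃ ρ : Equiv.Perm (Fin L), ∀ a b, ρ a < ρ b ↔ f a < f b := by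
  have hcard : (Finset.univ.image f).card = L := by
    rw [Finset.card_image_of_injective _ hf, Finset.card_fin]
  let g : Fin L → Fin L := fun a =>
    ((Finset.univ.image f).orderIsoOfFin hcard).symm ⟨f a, by simp⟩
  have hlt : ∀ a b, g a < g b ↔ f a < f b := fun a b => by
    simp only [g, OrderIso.lt_iff_lt, Subtype.mk_lt_mk]
  have hg : Function.Injective g := fun a b h => by
    have h₁ := hlt a b
    have h₂ := hlt b a
    rw [h] at h₁ h₂
    simp only [lt_self_iff_false, false_iff, not_lt] at h₁ h₂
    exact hf (le_antisymm h₂ h₁)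
  exact ⟨Equiv.ofBijective g (Finite.injective_iff_bijective.1 hg), hlt⟩

/-- Two matches of a minimal overlapping permutation share at most one position. -/
lemma MinOverlapping.add_le_of_matchAt {m n : ℕ} {τ : Equiv.Perm (Fin (m + 1))}
    (hτ : MinOverlapping τ) {σ : Equiv.Perm (Fin n)} {i i' : ℕ} (hi : MatchAt τ σ i)
    (hi' : MatchAt τ σ i') (hii' : i < i') : i + m ≤ i' := by
  have hex : ∃ d, 0 < d ∧ MatchAt τ σ (i + d) :=
    ⟨i' - i, by omega, by rwa [Nat.add_sub_cancel' hii'.le]⟩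
  obtain ⟨hd, hmatch⟩ := Nat.find_spec hex
  have hmin : ∀ p, p < Nat.find hex → 0 < p → ¬ MatchAt τ σ (i + p) :=
    fun p hp h₀ h => Nat.find_min hex hp ⟨h₀, h⟩
  have hle : Nat.find hex ≤ i' - i :=
    Nat.find_min' hex ⟨by omega, by rwa [Nat.add_sub_cancel' hii'.le]⟩
  generalize Nat.find hex = d at hd hmatch hmin hle
  by_contra! hlt
  have hn := hmatch.1
  obtain ⟨ρ, hρ⟩ := exists_perm_lt_iff_of_injective
    (fun a : Fin (d + (m + 1)) => σ ⟨i + a, by omega⟩)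
    (fun a b h => by
      have := σ.injective h
      simp only [Fin.mk.injEq] at this
      exact Fin.ext (by omega))
  have hiff : ∀ p, p ≤ d → (MatchAt τ ρ p ↔ MatchAt τ σ (i + p)) := by
    intro p hp
    simp only [MatchAt, hρ, add_assoc]
    exact ⟨fun ⟨_, h⟩ => ⟨by omega, h⟩, fun ⟨_, h⟩ => ⟨by omega, h⟩⟩
  have htwo : mch τ ρ = 2 := by
    have : (Finset.range (d + (m + 1))).filter (fun p => MatchAt τ ρ p) = {0, d} := by
      ext p
      simp only [Finset.mem_filter, Finset.mem_range, Finset.mem_insert,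
        Finset.mem_singleton]
      constructor
      · rintro ⟨-, hp⟩
        have hpd : p ≤ d := by have := hp.1; omega
        by_contra! hne
        exact hmin p (by omega) (by omega) ((hiff p hpd).1 hp)
      · rintro (rfl | rfl)
        · exact ⟨by omega, (hiff 0 hd.le).2 hi⟩
        · exact ⟨by omega, (hiff p le_rfl).2 hmatch⟩
    rw [mch, this, Finset.card_pair hd.ne]
  have := hτ.2 ⟨ρ, htwo⟩
  omega

/-- In a maximum packing for a minimal overlapping permutation, the matches start exactly at
the multiples of `m`. -/
lemma MinOverlapping.mch_eq_iff {m n : ℕ} (hm : 0 < m) (hn : 1 ≤ n)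
    {τ : Equiv.Perm (Fin (m + 1))} (hτ : MinOverlapping τ)
    (σ : Equiv.Perm (Fin (n * m + 1))) :
    mch τ σ = n ↔ ∀ k < n, MatchAt τ σ (k * m) := by
  have hbound : ∀ p, MatchAt τ σ p → p / m < n := fun p hp => by
    rw [Nat.div_lt_iff_lt_mul hm]
    have := hp.1
    omega
  have hlt : ∀ p q, MatchAt τ σ p → MatchAt τ σ q → p < q → p / m < q / m :=
    fun p q hp hq hpq => by
      have := Nat.div_le_div_right (c := m) (hτ.add_le_of_matchAt hp hq hpq)
      rw [Nat.add_div_right _ hm] at this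
      omega
  constructor
  · intro h
    have hsurj : ∀ k < n, ∃ p, MatchAt τ σ p ∧ p / m = k := by
      intro k hk
      obtain ⟨p, hp, hpk⟩ := Finset.surj_on_of_inj_on_of_card_le
        (s := (Finset.range (n * m + 1)).filter fun i => MatchAt τ σ i) (t := Finset.range n)
        (fun p _ => p / m) (fun p hp => by simpa using hbound p (Finset.mem_filter.1 hp).2)
        (fun p q hp hq hpq => by
          rcases lt_trichotomy p q with h | h | h
          · exact absurd hpq
              (hlt p q (Finset.mem_filter.1 hp).2 (Finset.mem_filter.1 hq).2 h).ne
          · exact h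
          · exact absurd hpq
              (hlt q p (Finset.mem_filter.1 hq).2 (Finset.mem_filter.1 hp).2 h).ne')
        (by rw [Finset.card_range]; exact h.ge) k (Finset.mem_range.2 hk)
      exact ⟨p, (Finset.mem_filter.1 hp).2, hpk.symm⟩
    have hmul : ∀ t k, k + t + 1 = n → MatchAt τ σ (k * m) := by
      intro t
      induction t with
      | zero =>
        rintro k rfl
        obtain ⟨p, hp, hpk⟩ := hsurj k (by omega)
        have h₁ := hp.1
        have h₂ := Nat.div_mul_le_self p m
        rw [hpk] at h₂
        rw [add_zero, add_mul] at h₁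
        rwa [show k * m = p by omega]
      | succ t ih =>
        intro k hk
        have hnext := ih (k + 1) (by omega)
        obtain ⟨p, hp, hpk⟩ := hsurj k (by omega)
        have h₂ := Nat.div_mul_le_self p m
        have h₃ : p < (k + 1) * m := (Nat.div_lt_iff_lt_mul hm).1 (by omega)
        have h₄ := hτ.add_le_of_matchAt hp hnext h₃
        rw [hpk] at h₂
        rw [add_mul] at h₄
        rwa [show k * m = p by omega]
    exact fun k hk => hmul (n - 1 - k) k (by omega)
  · intro h
    have himage : (Finset.range (n * m + 1)).filter (fun i => MatchAt τ σ i) =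
        (Finset.range n).image (· * m) := by
      ext p
      simp only [Finset.mem_filter, Finset.mem_range, Finset.mem_image]
      constructor
      · rintro ⟨-, hp⟩
        refine ⟨p / m, hbound p hp, ?_⟩
        by_contra hne
        have := hlt _ _ (h _ (hbound p hp)) hp
          (lt_of_le_of_ne (Nat.div_mul_le_self p m) hne)
        rw [Nat.mul_div_cancel _ hm] at this
        exact this.false
      · rintro ⟨k, hk, rfl⟩
        exact ⟨Nat.lt_succ_of_le (Nat.mul_le_mul_right m hk.le), h k hk⟩
    rw [mch, himage, Finset.card_image_of_injective _ (mul_left_injective₀ hm.ne'),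
      Finset.card_range]

/-- Applies `γ` to the position within each block of length `m`. -/
def blockMap {m : ℕ} (γ : Equiv.Perm (Fin (m + 1))) (p : ℕ) : ℕ :=
  p / m * m + γ (Fin.ofNat (m + 1) (p % m))

lemma blockMap_mul_add {m : ℕ} (hm : 0 < m) {γ : Equiv.Perm (Fin (m + 1))} (h₀ : γ 0 = 0)
    (hlast : γ (Fin.last m) = Fin.last m) (k : ℕ) (b : Fin (m + 1)) :
    blockMap γ (k * m + b) = k * m + γ b := by
  rcases (Fin.le_last b).lt_or_eq with hb | rfl
  · have hb : (b : ℕ) < m := hb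
    have hdiv : (k * m + b) / m = k := by
      rw [mul_comm, Nat.mul_add_div hm, Nat.div_eq_of_lt hb, add_zero]
    have hmod : (k * m + b) % m = b := by
      rw [mul_comm, Nat.mul_add_mod, Nat.mod_eq_of_lt hb]
    rw [blockMap, hdiv, hmod, Fin.ofNat_val_eq_self]
  · have hsum : k * m + (Fin.last m : ℕ) = (k + 1) * m := by
      rw [Fin.val_last, add_mul, one_mul]
    rw [hlast, hsum, blockMap, Nat.mul_div_cancel _ hm, Nat.mul_mod_left]
    simp [h₀]

lemma blockMap_inv_blockMap {m : ℕ} (hm : 0 < m) {γ : Equiv.Perm (Fin (m + 1))}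
    (h₀ : γ 0 = 0) (hlast : γ (Fin.last m) = Fin.last m) (p : ℕ) :
    blockMap γ⁻¹ (blockMap γ p) = p := by
  have h₀' : γ⁻¹ 0 = 0 := by rw [Equiv.Perm.inv_eq_iff_eq, h₀]
  have hlast' : γ⁻¹ (Fin.last m) = Fin.last m := by rw [Equiv.Perm.inv_eq_iff_eq, hlast]
  rw [show blockMap γ p = p / m * m + γ (Fin.ofNat (m + 1) (p % m)) from rfl,
    blockMap_mul_add hm h₀' hlast', Equiv.Perm.coe_inv, Equiv.symm_apply_apply, Fin.val_ofNat,
    Nat.mod_eq_of_lt ((Nat.mod_lt p hm).trans (Nat.lt_succ_self m)), mul_comm,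
    Nat.div_add_mod]

lemma blockMap_lt {m n : ℕ} (hm : 0 < m) {γ : Equiv.Perm (Fin (m + 1))} (h₀ : γ 0 = 0)
    {p : ℕ} (hp : p < n * m + 1) : blockMap γ p < n * m + 1 := by
  rcases (Nat.lt_succ_iff.1 hp).lt_or_eq with h | rfl
  · have hk : p / m + 1 ≤ n := (Nat.div_lt_iff_lt_mul hm).2 h
    have hle := Nat.mul_le_mul_right m hk
    rw [add_mul, one_mul] at hle
    have := (γ (Fin.ofNat (m + 1) (p % m))).isLt
    rw [blockMap]
    omega
  · rw [blockMap, Nat.mul_div_cancel _ hm, Nat.mul_mod_left]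
    simp [h₀]

/-- Rearranging every block by `α⁻¹ β` turns maximum packings for `α` into maximum packings
for `β`. -/
lemma card_maximum_packings_le {m n : ℕ} (hm : 0 < m) (hn : 1 ≤ n)
    {α β : Equiv.Perm (Fin (m + 1))} (hα : MinOverlapping α) (hβ : MinOverlapping β)
    (h₀ : α 0 = β 0) (hlast : α (Fin.last m) = β (Fin.last m)) :
    (Finset.univ.filter fun σ : Equiv.Perm (Fin (n * m + 1)) => mch α σ = n).card ≤
      (Finset.univ.filter fun σ : Equiv.Perm (Fin (n * m + 1)) => mch β σ = n).card := by
  set γ := α⁻¹ * β with hγ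
  have hγ₀ : γ 0 = 0 := by rw [hγ, Equiv.Perm.mul_apply, ← h₀, Equiv.Perm.coe_inv, Equiv.symm_apply_apply]
  have hγlast : γ (Fin.last m) = Fin.last m := by
    rw [hγ, Equiv.Perm.mul_apply, ← hlast, Equiv.Perm.coe_inv, Equiv.symm_apply_apply]
  let f : Fin (n * m + 1) → Fin (n * m + 1) := fun p => ⟨blockMap γ p, blockMap_lt hm hγ₀ p.2⟩
  have hf : Function.Injective f := fun p q h => by
    have h := congrArg (blockMap γ⁻¹) (Fin.mk.inj h)
    rw [blockMap_inv_blockMap hm hγ₀ hγlast, blockMap_inv_blockMap hm hγ₀ hγlast] at h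
    exact Fin.ext h
  let π : Equiv.Perm (Fin (n * m + 1)) :=
    Equiv.ofBijective f (Finite.injective_iff_bijective.1 hf)
  refine Finset.card_le_card_of_injOn (· * π) ?_ (mul_left_injective π).injOn
  intro σ hσ
  simp only [Finset.coe_filter, Finset.mem_univ, true_and, Set.mem_ofPred_eq] at hσ ⊢
  rw [hα.mch_eq_iff hm hn] at hσ
  rw [hβ.mch_eq_iff hm hn]
  intro k hk
  obtain ⟨h, hmatch⟩ := hσ k hk
  refine ⟨h, fun a b => ?_⟩
  have hπ : ∀ c : Fin (m + 1), π ⟨k * m + c, by omega⟩ = ⟨k * m + γ c, by omega⟩ :=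
    fun c => Fin.ext (blockMap_mul_add hm hγ₀ hγlast k c)
  have hβγ : ∀ c, β c = α (γ c) := fun c => by
    rw [hγ, Equiv.Perm.mul_apply, Equiv.Perm.coe_inv, Equiv.apply_symm_apply]
  simp only [Equiv.Perm.mul_apply, hπ, hβγ]
  exact hmatch (γ a) (γ b)

/-- Theorem (Duane–Remmel): if `α, β ∈ S_j` (`j ≥ 3`) are minimal overlapping with
`α_1 = β_1` and `α_j = β_j`, then for all `n ≥ 1`,
`mp_{α,n(j-1)+1} = mp_{β,n(j-1)+1}` (numbers of maximum packings agree). -/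
theorem stmt4 {j : ℕ} (hj : 3 ≤ j) (α β : Equiv.Perm (Fin j))
    (hα : MinOverlapping α) (hβ : MinOverlapping β)
    (hfirst : α ⟨0, by omega⟩ = β ⟨0, by omega⟩)
    (hlast : α ⟨j - 1, by omega⟩ = β ⟨j - 1, by omega⟩) :
    ∀ n : ℕ, 1 ≤ n →
      (Finset.univ.filter
        (fun σ : Equiv.Perm (Fin (n * (j - 1) + 1)) => mch α σ = n)).card =
      (Finset.univ.filter
        (fun σ : Equiv.Perm (Fin (n * (j - 1) + 1)) => mch β σ = n)).card := by
  obtain ⟨m, rfl⟩ : ∃ m, j = m + 1 := ⟨j - 1, by omega⟩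
  intro n hn
  exact le_antisymm
    (card_maximum_packings_le (by omega) hn hα hβ hfirst hlast)
    (card_maximum_packings_le (by omega) hn hβ hα hfirst.symm hlast.symm)

end CWilf
end
end
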